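/- Let p and q be primes with p ≡ 5 (mod 8) and q ≡ 3 (mod 4), and suppose that p is a quadratic residue modulo q. Then the 2-Sylow subgroup of the ideal class group of ℚ(√−pq) is cyclic, and its order is divisible by 4; in particular 4 divides the class number of ℚ(√−pq). -/

import Mathlib

open NumberField IntermediateField

/-- The imaginary quadratic field `ℚ(√-n) ⊂ ℂ`. -/
noncomputable def Qsqrtneg (n : ℕ) : IntermediateField ℚ ℂ := ℚ⟮(Complex.I * Real.sqrt n : ℂ)⟯

theorem isCyclic_of_sq_eq_one {G : Type*} [CommGroup G] [Finite G] (hG : IsPGroup 2 G) (t : G)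
    (ht : ∀ x : G, x ^ 2 = 1 → x = 1 ∨ x = t) : IsCyclic G := by
  classical
  have := Fintype.ofFinite G
  have hpow : ∀ k : ℕ, (Finset.univ.filter fun x : G => x ^ 2 ^ k = 1).card ≤ 2 ^ k := by
    intro k
    induction k with
    | zero => simp [Finset.card_le_one]
    | succ k ih =>
      rw [pow_succ']
      refine (Finset.card_le_mul_card_image_of_maps_to (f := fun x : G => x ^ 2)
        (t := Finset.univ.filter fun x : G => x ^ 2 ^ k = 1) ?_ 2 ?_).trans
        (Nat.mul_le_mul_left 2 ih)
      · intro x hx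
        simpa [← pow_mul, ← pow_succ'] using hx
      · intro y _
        by_cases hy : ∃ x₀ : G, x₀ ^ 2 = y
        · obtain ⟨x₀, rfl⟩ := hy
          refine (Finset.card_le_card (t := {x₀, t * x₀}) fun x hx => ?_).trans
            Finset.card_le_two
          have hx : x ^ 2 = x₀ ^ 2 := (Finset.mem_filter.mp hx).2
          have := ht (x / x₀) (by rw [div_pow, hx, div_self'])
          simpa [div_eq_iff_eq_mul] using this
        · push Not at hy
          simp [hy]
  refine isCyclic_of_card_pow_eq_one_le fun n hn => ?_
  obtain ⟨m, hm⟩ := (IsPGroup.iff_card).mp hG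
  obtain ⟨k, -, hk⟩ := (Nat.dvd_prime_pow Nat.prime_two).mp (hm ▸ Nat.gcd_dvd_right n (Nat.card G))
  calc _ ≤ (Finset.univ.filter fun x : G => x ^ 2 ^ k = 1).card := by
        refine Finset.card_le_card fun x hx => ?_
        have hx : x ^ n = 1 := (Finset.mem_filter.mp hx).2
        have : x ^ n.gcd (Nat.card G) = 1 := by
          rw [pow_gcd_eq_one]
          exact ⟨hx, pow_card_eq_one'⟩
        exact Finset.mem_filter.mpr ⟨Finset.mem_univ x, by rw [← hk, ← hm]; exact this⟩
    _ ≤ 2 ^ k := hpow k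
    _ ≤ n := hk ▸ Nat.gcd_le_left _ hn
theorem exists_sq_eq_mul_sq_add_mul_sq {p q : ℕ} (hp : p.Prime) (hq : q.Prime)
    (hpq : IsSquare (p : ZMod q)) (hqp : IsSquare (q : ZMod p)) (hne : p ≠ q) :
    ∃ x y z : ℤ, z ≠ 0 ∧ z ^ 2 = p * x ^ 2 + q * y ^ 2 := by
  have : NeZero p := ⟨hp.ne_zero⟩
  have : NeZero q := ⟨hq.ne_zero⟩
  obtain ⟨r, hr⟩ := hpq
  obtain ⟨s, hs⟩ := hqp
  let f : ℕ × ℕ × ℕ → ZMod q × ZMod p := fun v =>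
    ((v.2.2 : ZMod q) - r * v.1, (v.2.2 : ZMod p) - s * v.2.1)
  have hcard : (Finset.univ : Finset (ZMod q × ZMod p)).card <
      (Finset.range (q.sqrt + 1) ×ˢ Finset.range (p.sqrt + 1) ×ˢ
        Finset.range ((p * q).sqrt + 1)).card := by
    simp only [Finset.card_univ, Fintype.card_prod, ZMod.card, Finset.card_product,
      Finset.card_range]
    have h1 := Nat.lt_succ_sqrt q
    have h2 := Nat.lt_succ_sqrt p
    have h3 := Nat.lt_succ_sqrt (p * q)
    simp only [Nat.succ_eq_add_one] at h1 h2 h3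
    have h4 := Nat.mul_lt_mul'' (Nat.mul_lt_mul'' h1 h2) h3
    by_contra! hle
    have := Nat.mul_le_mul hle hle
    nlinarith
  obtain ⟨⟨a, b, c⟩, hv, ⟨a', b', c'⟩, hv', hvv, hf⟩ :=
    Finset.exists_ne_map_eq_of_card_lt_of_maps_to hcard (f := f) (by simp [Set.MapsTo])
  simp only [Finset.mem_product, Finset.mem_range, Nat.lt_succ_iff] at hv hv'
  simp only [f, Prod.mk.injEq] at hf
  have hbound : ∀ {n u v : ℕ}, u ≤ n.sqrt → v ≤ n.sqrt → ((u : ℤ) - v) ^ 2 ≤ n := by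
    intro n u v hu hv
    have h := Nat.sqrt_le n
    have h1 : ((u : ℤ) - v) ^ 2 ≤ (n.sqrt : ℤ) ^ 2 :=
      sq_le_sq' (by lia) (by lia)
    have h2 : (n.sqrt : ℤ) ^ 2 ≤ n := by rw [sq]; exact_mod_cast h
    lia
  have hx := hbound hv.1 hv'.1
  have hy := hbound hv.2.1 hv'.2.1
  have hz := hbound hv.2.2 hv'.2.2
  have hxyz : ¬ ((a : ℤ) - a' = 0 ∧ (b : ℤ) - b' = 0 ∧ (c : ℤ) - c' = 0) := by
    rintro ⟨h1, h2, h3⟩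
    exact hvv (by simp only [Prod.mk.injEq]; lia)
  have hdq : (q : ℤ) ∣ ((c : ℤ) - c') ^ 2 - p * ((a : ℤ) - a') ^ 2 := by
    rw [← ZMod.intCast_zmod_eq_zero_iff_dvd]
    push_cast
    rw [hr]
    linear_combination ((c : ZMod q) - c' + r * (a - a')) * hf.1
  have hdp : (p : ℤ) ∣ ((c : ℤ) - c') ^ 2 - q * ((b : ℤ) - b') ^ 2 := by
    rw [← ZMod.intCast_zmod_eq_zero_iff_dvd]
    push_cast
    rw [hs]
    linear_combination ((c : ZMod p) - c' + s * (b - b')) * hf.2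
  generalize (a : ℤ) - a' = x at *
  generalize (b : ℤ) - b' = y at *
  generalize (c : ℤ) - c' = z at *
  have hp0 : (0 : ℤ) < p := by exact_mod_cast hp.pos
  have hq0 : (0 : ℤ) < q := by exact_mod_cast hq.pos
  have hnsq : ∀ {n : ℕ}, n.Prime → ∀ u : ℤ, u ^ 2 ≠ n := by
    intro n hn u hu
    exact (Nat.prime_iff_prime_int.mp hn).irreducible.not_isSquare ⟨u, by rw [← hu, sq]⟩
  have hx' : x ^ 2 < q := lt_of_le_of_ne hx (hnsq hq x)
  have hy' : y ^ 2 < p := lt_of_le_of_ne hy (hnsq hp y)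
  have hcop : IsCoprime (p : ℤ) q :=
    Nat.isCoprime_iff_coprime.mpr ((Nat.coprime_primes hp hq).mpr hne)
  have hz' : z ^ 2 < p * q := by
    refine lt_of_le_of_ne (by exact_mod_cast hz) fun h => ?_
    have h1 : (p : ℤ) ∣ z :=
      (Nat.prime_iff_prime_int.mp hp).dvd_of_dvd_pow ⟨q, h⟩
    obtain ⟨w, rfl⟩ := h1
    have h2 : (q : ℤ) = p * w ^ 2 :=
      mul_left_cancel₀ hp0.ne' (by linear_combination -h)
    have h3 : IsUnit (p : ℤ) := hcop.isUnit_of_dvd' dvd_rfl ⟨_, h2⟩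
    exact (Nat.prime_iff_prime_int.mp hp).not_isUnit h3
  have hdvd : (p : ℤ) * q ∣ z ^ 2 - p * x ^ 2 - q * y ^ 2 := by
    refine hcop.mul_dvd ?_ ?_
    · convert! hdp.sub (Dvd.intro (x ^ 2) rfl) using 1
      ring
    · exact hdq.sub (Dvd.intro _ rfl)
  obtain ⟨t, ht⟩ := hdvd
  have hpq0 : (0 : ℤ) < p * q := by positivity
  have ht1 : t < 1 := by
    by_contra! h
    nlinarith [mul_nonneg hp0.le (sq_nonneg x), mul_nonneg hq0.le (sq_nonneg y)]
  have ht2 : -2 < t := by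
    by_contra! h
    nlinarith [sq_nonneg z]
  obtain rfl | rfl : t = 0 ∨ t = -1 := by lia
  · refine ⟨x, y, z, ?_, by linarith⟩
    rintro rfl
    have h1 : 0 ≤ p * x ^ 2 := by positivity
    have h2 : 0 ≤ q * y ^ 2 := by positivity
    have h3 : (p : ℤ) * x ^ 2 = 0 := by linarith
    have h4 : (q : ℤ) * y ^ 2 = 0 := by linarith
    refine hxyz ⟨?_, ?_, rfl⟩
    · simpa [hp.ne_zero] using h3
    · simpa [hq.ne_zero] using h4
  · refine ⟨x * z + q * y, y * z - p * x, z ^ 2 + p * q, by positivity, ?_⟩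
    have h : z ^ 2 + p * q = p * x ^ 2 + q * y ^ 2 := by linarith
    linear_combination (z ^ 2 + (p : ℤ) * q) * h

section

open Ideal

theorem map_span_pair {R : Type*} [CommRing R] {σ : R ≃+* R} {n : ℕ} {d : R} (hd : σ d = -d) :
    (span {(n : R), d}).map σ = span {(n : R), d} := by
  rw [map_span, Set.image_pair, map_natCast, hd, span_insert, span_singleton_neg, ← span_insert]

theorem span_pair_mul_span_pair {R : Type*} [CommRing R] {p q : ℕ} (hpq : p.Coprime q) {d : R}
    (hd : d * d = -((p * q : ℕ) : R)) :
    span {(p : R), d} * span {(p : R), d} = span {(p : R)} := by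
  refine le_antisymm ?_ ?_
  · rw [Ideal.span_mul_span', span_le]
    rintro _ ⟨x, hx, y, hy, rfl⟩
    simp only [Set.mem_insert_iff, Set.mem_singleton_iff] at hx hy
    rw [SetLike.mem_coe, Ideal.mem_span_singleton]
    obtain rfl | rfl := hx <;> obtain rfl | rfl := hy
    · exact dvd_mul_right _ _
    · exact dvd_mul_right _ _
    · exact dvd_mul_left _ _
    · simp only [hd]
      exact (dvd_neg.mpr (by rw [Nat.cast_mul]; exact dvd_mul_right _ _))
  · rw [span_singleton_le_iff_mem]
    obtain ⟨a, b, hab⟩ := Nat.isCoprime_iff_coprime.mpr hpq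
    have hab' : (a : R) * p + b * q = 1 := by simpa using congrArg (Int.cast : ℤ → R) hab
    have hp : (p : R) ∈ span {(p : R), d} := subset_span (by simp)
    have hd' : d ∈ span {(p : R), d} := subset_span (by simp)
    convert! sub_mem (mul_mem_left _ (a : R) (mul_mem_mul hp hp))
      (mul_mem_left _ (b : R) (mul_mem_mul hd' hd')) using 1
    rw [hd, Nat.cast_mul]
    linear_combination -(p : R) * hab'

section Conj

variable {R : Type*} [CommRing R] [IsDedekindDomain R]

theorem dvd_of_sq_eq {z m a b : R} (hm : m ≠ 0) (h : z ^ 2 = m * a * z + m ^ 2 * b) : m ∣ z := by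
  have hJ : (span {z} ⊔ span {m}) * (span {z} ⊔ span {m}) ≤
      span {m} * (span {z} ⊔ span {m}) := by
    have hz : z ∈ span {z} ⊔ span {m} := mem_sup_left (mem_span_singleton_self z)
    have hm' : m ∈ span {z} ⊔ span {m} := mem_sup_right (mem_span_singleton_self m)
    have hmm : m ∈ span {m} := mem_span_singleton_self m
    rw [Ideal.sup_mul]
    refine sup_le ?_ (mul_mono_left le_rfl)
    rw [Ideal.mul_sup, span_singleton_mul_span_singleton, span_singleton_mul_span_singleton]
    simp only [sup_le_iff, span_singleton_le_iff_mem]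
    refine ⟨?_, ?_⟩
    · have : z * z = m * (a * z + b * m) := by linear_combination h
      rw [this]
      exact mul_mem_mul hmm (add_mem (mul_mem_left _ a hz) (mul_mem_left _ b hm'))
    · rw [mul_comm z m]
      exact mul_mem_mul hmm hz
  rw [← dvd_iff_le] at hJ
  have hne : span {z} ⊔ span {m} ≠ ⊥ := by
    intro h0
    have : m ∈ span {z} ⊔ span {m} := mem_sup_right (mem_span_singleton_self m)
    rw [h0] at this
    exact hm (by simpa using this)
  have h1 := (mul_dvd_mul_iff_right hne).mp hJ
  rw [dvd_iff_le] at h1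
  exact mem_span_singleton.mp (h1 (mem_sup_left (mem_span_singleton_self z)))

theorem Ideal.eq_of_mul_self_eq {I J : Ideal R} (h : I * I = J * J) : I = J := by
  have key : ∀ {I J : Ideal R}, I * I = J * J → I ∣ J := by
    intro I J h
    rw [← sq, ← sq] at h
    exact (UniqueFactorizationMonoid.pow_dvd_pow_iff_dvd two_ne_zero).mp h.dvd
  exact le_antisymm (dvd_iff_le.mp (key h.symm)) (dvd_iff_le.mp (key h))

variable [CharZero R] {σ : R ≃+* R}

theorem intCast_dvd_intCast_of_fixed (hfix : ∀ x, σ x = x → ∃ n : ℤ, x = n) {m n : ℤ}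
    (h : (m : R) ∣ n) : m ∣ n := by
  obtain ⟨x, hx⟩ := h
  by_cases hm : m = 0
  · subst hm
    rw [Int.cast_zero, zero_mul] at hx
    have : n = 0 := by exact_mod_cast hx
    simp [this]
  · have hm' : (m : R) ≠ 0 := by exact_mod_cast hm
    have h1 := congrArg σ hx
    rw [map_mul, map_intCast, map_intCast, hx] at h1
    obtain ⟨k, rfl⟩ := hfix x (mul_left_cancel₀ hm' h1).symm
    exact ⟨k, by exact_mod_cast hx⟩

theorem natCast_dvd_natCast_of_fixed (hfix : ∀ x, σ x = x → ∃ n : ℤ, x = n) {m n : ℕ}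
    (h : (m : R) ∣ n) : m ∣ n := by
  have : (m : ℤ) ∣ n := intCast_dvd_intCast_of_fixed hfix (by exact_mod_cast h)
  exact_mod_cast this

theorem eq_of_span_natCast_eq (hfix : ∀ x, σ x = x → ∃ n : ℤ, x = n) {m n : ℕ}
    (h : span {(m : R)} = span {(n : R)}) : m = n := by
  refine Nat.dvd_antisymm (natCast_dvd_natCast_of_fixed hfix ?_)
    (natCast_dvd_natCast_of_fixed hfix ?_)
  · exact span_singleton_le_span_singleton.mp h.ge
  · exact span_singleton_le_span_singleton.mp h.le

theorem exists_mul_map_eq_span (hfix : ∀ x, σ x = x → ∃ n : ℤ, x = n)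
    (hσ : ∀ x, σ (σ x) = x) {I : Ideal R} (hI : I ≠ ⊥) :
    ∃ m : ℕ, m ≠ 0 ∧ I * I.map σ = span {(m : R)} := by
  obtain ⟨m, hm⟩ := (IsPrincipalIdealRing.principal
    ((I * I.map σ).comap (Int.castRingHom R))).principal
  have hmem : ∀ n : ℤ, (n : R) ∈ I * I.map σ ↔ m ∣ n := by
    intro n
    rw [← Ideal.mem_span_singleton, ← Ideal.submodule_span_eq, ← hm]
    simp [Ideal.mem_comap]
  have hprod : ∀ {x y : R}, x ∈ I → y ∈ I → x * σ y ∈ I * I.map σ := fun hx hy =>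
    mul_mem_mul hx (mem_map_of_mem σ hy)
  have hnorm : ∀ {x : R}, x ∈ I → ∃ u : ℤ, x * σ x = (m : R) * u := by
    intro x hx
    obtain ⟨u, hu⟩ := hfix (x * σ x) (by rw [map_mul, hσ, mul_comm])
    obtain ⟨v, rfl⟩ := (hmem u).mp (hu ▸ hprod hx hx)
    exact ⟨v, by rw [hu, Int.cast_mul]⟩
  have hm0 : m ≠ 0 := by
    rintro rfl
    obtain ⟨x, hx, hx0⟩ := Submodule.exists_mem_ne_zero_of_ne_bot hI
    obtain ⟨u, hu⟩ := hnorm hx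
    simp [hx0] at hu
  have hle : I * I.map σ ≤ span {(m : R)} := by
    rw [Ideal.mul_le]
    intro x hx s hs
    obtain ⟨y, hy, rfl⟩ := (mem_map_of_equiv σ s).mp hs
    obtain ⟨t, ht⟩ := hfix (x * σ y + y * σ x) (by simp only [map_add, map_mul, hσ]; ring)
    obtain ⟨a, rfl⟩ := (hmem t).mp (ht ▸ add_mem (hprod hx hy) (hprod hy hx))
    obtain ⟨u, hu⟩ := hnorm hx
    obtain ⟨v, hv⟩ := hnorm hy
    rw [Ideal.mem_span_singleton]
    refine dvd_of_sq_eq (a := a) (b := -(u * v)) (by exact_mod_cast hm0) ?_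
    push_cast at ht
    linear_combination x * σ y * ht - y * σ y * hu - m * u * hv
  have heq : I * I.map σ = span {(m : R)} :=
    le_antisymm hle ((span_singleton_le_iff_mem _).mpr ((hmem m).mpr dvd_rfl))
  refine ⟨m.natAbs, by simpa using hm0, heq.trans ?_⟩
  obtain h | h := Int.natAbs_eq m
  · conv_lhs => rw [h]
    simp
  · conv_lhs => rw [h]
    simp [span_singleton_neg]

theorem exists_map_span_mul_eq (hfix : ∀ x, σ x = x → ∃ n : ℤ, x = n)
    (hσ : ∀ x, σ (σ x) = x) (hpos : ∀ x, ∃ n : ℕ, x * σ x = n) {I : Ideal R} (hI : I ≠ ⊥)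
    {a : R} (ha : I * I = span {a}) :
    ∃ b : R, b ≠ 0 ∧ (span {b} * I).map σ = span {b} * I := by
  obtain ⟨m, hm0, hm⟩ := exists_mul_map_eq_span hfix hσ hI
  have ha0 : span {a} ≠ ⊥ := ha ▸ mul_ne_zero hI hI
  have hmap : ∀ c : R, (span {c}).map σ = span {σ c} := fun c => by
    rw [map_span, Set.image_singleton]
  have hnorm : a * σ a = m * m := by
    obtain ⟨n, hn⟩ := hpos a
    have h : span {(n : R)} = span {((m * m : ℕ) : R)} := by
      rw [← hn, ← span_singleton_mul_span_singleton, ← hmap, ← ha, Ideal.map_mul, Nat.cast_mul,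
        ← span_singleton_mul_span_singleton, ← hm]
      ring
    rw [hn, eq_of_span_natCast_eq hfix h, Nat.cast_mul]
  have hmI : span {(m : R)} * I = span {a} * I.map σ := by
    rw [← hm, ← ha]
    ring
  by_cases h0 : (m : R) + a = 0
  · refine ⟨1, one_ne_zero, ?_⟩
    have : a = -m := by linear_combination h0
    rw [this, span_singleton_neg] at hmI
    have hm' : span {(m : R)} ≠ ⊥ := by simpa using hm0
    simpa using (mul_left_cancel₀ hm' hmI).symm
  · refine ⟨σ (m + a), (map_ne_zero_iff σ σ.injective).mpr h0, ?_⟩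
    refine mul_left_cancel₀ ha0 ?_
    rw [Ideal.map_mul, hmap, hσ]
    calc span {a} * (span {(m : R) + a} * I.map σ)
        = span {(m : R) + a} * (span {a} * I.map σ) := by ring
      _ = span {a * σ (m + a)} * I := by
        rw [← hmI, ← mul_assoc, span_singleton_mul_span_singleton, map_add, map_natCast]
        congr 3
        linear_combination -hnorm
      _ = _ := by rw [← span_singleton_mul_span_singleton, mul_assoc]

theorem exists_mul_self_eq_span_of_map_eq (hfix : ∀ x, σ x = x → ∃ n : ℤ, x = n)
    (hσ : ∀ x, σ (σ x) = x) {ω : R} {N : ℕ}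
    (hω : (ω - σ ω) * (ω - σ ω) = -(N : R)) {J : Ideal R} (hJ : J ≠ ⊥) (hJσ : J.map σ = J) :
    ∃ (k n : ℕ) (J' : Ideal R), k ≠ 0 ∧ n ∣ N ∧ J = span {(k : R)} * J' ∧
      J' * J' = span {(n : R)} := by
  obtain ⟨M, hM0, hM⟩ := exists_mul_map_eq_span hfix hσ hJ
  rw [hJσ] at hM
  obtain ⟨n, k, rfl, hn⟩ := Nat.sq_mul_squarefree M
  have hk0 : k ≠ 0 := by rintro rfl; simp at hM0
  have hk : span {(k : R)} ≠ ⊥ := by simpa using hk0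
  have hM' : J * J = span {(k : R)} * span {(k : R)} * span {(n : R)} := by
    rw [hM, span_singleton_mul_span_singleton, span_singleton_mul_span_singleton]
    push_cast
    rw [sq]
  obtain ⟨J', rfl⟩ : span {(k : R)} ∣ J := by
    refine (UniqueFactorizationMonoid.pow_dvd_pow_iff_dvd two_ne_zero).mp ?_
    rw [sq, sq, hM']
    exact dvd_mul_right _ _
  have hJ' : J' * J' = span {(n : R)} := by
    refine mul_left_cancel₀ (mul_ne_zero hk hk) ?_
    rw [← hM']
    ring
  have hJσ' : J'.map σ = J' := by
    refine mul_left_cancel₀ hk ?_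
    rw [Ideal.map_mul, map_span, Set.image_singleton, map_natCast] at hJσ
    exact hJσ
  refine ⟨k, n, J', hk0, ?_, rfl, hJ'⟩
  have htr : ∀ x ∈ J', (n : R) ∣ x + σ x := by
    intro x hx
    have hmem : x + σ x ∈ J' := add_mem hx (by
      have := mem_map_of_mem σ hx
      rwa [hJσ'] at this)
    obtain ⟨t, ht⟩ := hfix (x + σ x) (by rw [map_add, hσ, add_comm])
    rw [ht] at hmem ⊢
    have h2 : (n : R) ∣ t * t := by
      rw [← Ideal.mem_span_singleton, ← hJ']
      exact mul_mem_mul hmem hmem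
    have h3 : (n : ℤ) ∣ t * t := intCast_dvd_intCast_of_fixed hfix (by exact_mod_cast h2)
    rw [← sq] at h3
    have h4 : (n : ℤ) ∣ t :=
      ((Int.squarefree_natCast.mpr hn).dvd_pow_iff_dvd two_ne_zero).mp h3
    simpa using map_dvd (Int.castRingHom R) h4
  have hle : J' * span {ω - σ ω} ≤ span {(n : R)} := by
    rw [Ideal.mul_le]
    intro x hx y hy
    obtain ⟨c, rfl⟩ := mem_span_singleton.mp hy
    rw [Ideal.mem_span_singleton, ← mul_assoc]
    refine dvd_mul_of_dvd_left ?_ c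
    have h1 := htr (x * ω) (mul_mem_right _ _ hx)
    have h2 := (htr x hx).mul_right (σ ω)
    convert! dvd_sub h1 h2 using 1
    rw [map_mul]
    ring
  have hn0 : span {(n : R)} ≠ ⊥ := by simpa using hn.ne_zero
  have h := mul_mono hle hle
  have h' : span {(n : R)} * span {(N : R)} ≤ span {(n : R)} * span {(n : R)} := by
    refine le_trans (le_of_eq ?_) h
    rw [← hJ', ← span_singleton_neg (N : R), ← hω, ← span_singleton_mul_span_singleton]
    ring
  rw [← dvd_iff_le, mul_dvd_mul_iff_left hn0, dvd_iff_le, span_singleton_le_span_singleton] at h'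
  exact natCast_dvd_natCast_of_fixed hfix h'

theorem not_isPrincipal_span_pair (hfix : ∀ x, σ x = x → ∃ n : ℤ, x = n)
    (hσ : ∀ x, σ (σ x) = x) (hpos : ∀ x, ∃ n : ℕ, x * σ x = n) {p q : ℕ} (hp : p.Prime)
    (hq : q.Prime) (hp8 : p % 8 = 5) (hq4 : q % 4 = 3) {d : R}
    (hd : d * d = -((p * q : ℕ) : R)) (hσd : σ d = -d) :
    ¬ (span {(p : R), d}).IsPrincipal := by
  have hne : p ≠ q := by lia
  have hcop : p.Coprime q := (Nat.coprime_primes hp hq).mpr hne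
  rintro ⟨g, hg⟩
  rw [submodule_span_eq] at hg
  obtain ⟨n, hn⟩ := hpos g
  obtain rfl : n = p := by
    refine eq_of_span_natCast_eq hfix ?_
    have hgσ := map_span_pair (n := p) hσd
    rw [hg, map_span, Set.image_singleton] at hgσ
    rw [← span_pair_mul_span_pair hcop hd, ← hn, ← span_singleton_mul_span_singleton, hgσ, hg]
  obtain ⟨u, hu⟩ := hfix (g + σ g) (by rw [map_add, hσ, add_comm])
  obtain ⟨w, hw⟩ := hfix ((g - σ g) * d) (by rw [map_mul, map_sub, hσ, hσd]; ring)
  have heq : (n : ℤ) * q * u ^ 2 + w ^ 2 = 4 * n * (n * q) := by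
    have : ((n : R) * q * u ^ 2 + w ^ 2) = 4 * n * (n * q) := by
      rw [← hu, ← hw]
      push_cast at hd
      linear_combination (g - σ g) ^ 2 * hd + 4 * (n : R) * q * hn
    exact_mod_cast this
  have hp' := Nat.prime_iff_prime_int.mp hp
  have hq' := Nat.prime_iff_prime_int.mp hq
  have hn0 : (0 : ℤ) < n := by exact_mod_cast hp.pos
  have hq0 : (0 : ℤ) < q := by exact_mod_cast hq.pos
  have hcop' : IsCoprime (n : ℤ) q := Nat.isCoprime_iff_coprime.mpr hcop
  obtain ⟨v, rfl⟩ : (n : ℤ) * q ∣ w := by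
    refine hcop'.mul_dvd (hp'.dvd_of_dvd_pow (n := 2) ⟨4 * (n * q) - q * u ^ 2, ?_⟩)
      (hq'.dvd_of_dvd_pow (n := 2) ⟨4 * n * n - n * u ^ 2, ?_⟩)
    · linear_combination heq
    · linear_combination heq
  have heq' : u ^ 2 + n * q * v ^ 2 = 4 * n := by
    have : (n : ℤ) * q ≠ 0 := by positivity
    refine mul_left_cancel₀ this ?_
    linear_combination heq
  obtain ⟨t, rfl⟩ : (n : ℤ) ∣ u :=
    hp'.dvd_of_dvd_pow (n := 2) ⟨4 - q * v ^ 2, by linear_combination heq'⟩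
  have heq2 : n * t ^ 2 + q * v ^ 2 = 4 := by
    refine mul_left_cancel₀ hn0.ne' ?_
    linear_combination heq'
  have h5 : (5 : ℤ) ≤ n := by lia
  have h3 : (3 : ℤ) ≤ q := by lia
  have ht : t = 0 := by
    by_contra h
    have : 0 < t ^ 2 := by positivity
    nlinarith [mul_nonneg hq0.le (sq_nonneg v)]
  subst ht
  have hv1 : v ^ 2 < 2 := by nlinarith
  have hv2 : v ^ 2 = 0 ∨ v ^ 2 = 1 := by
    have := sq_nonneg v
    lia
  obtain h | h := hv2 <;> rw [h] at heq2 <;> lia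

open nonZeroDivisors in
theorem eq_one_or_eq_mk0_of_sq_eq_one (hfix : ∀ x, σ x = x → ∃ n : ℤ, x = n)
    (hσ : ∀ x, σ (σ x) = x) (hpos : ∀ x, ∃ n : ℕ, x * σ x = n) {p q : ℕ} (hp : p.Prime)
    (hq : q.Prime) (hne : p ≠ q) {ω : R}
    (hω : (ω - σ ω) * (ω - σ ω) = -((p * q : ℕ) : R))
    (hP : span {(p : R), ω - σ ω} ∈ (Ideal R)⁰) {C : ClassGroup R} (hC : C ^ 2 = 1) :
    C = 1 ∨ C = ClassGroup.mk0 ⟨_, hP⟩ := by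
  have hPP := span_pair_mul_span_pair ((Nat.coprime_primes hp hq).mpr hne) hω
  obtain ⟨⟨I, hI⟩, rfl⟩ := ClassGroup.mk0_surjective C
  rw [sq, ← map_mul, Submonoid.mk_mul_mk, ClassGroup.mk0_eq_one_iff] at hC
  obtain ⟨a, ha⟩ := hC
  have hI0 : I ≠ ⊥ := nonZeroDivisors.ne_zero hI
  obtain ⟨b, hb0, hb⟩ := exists_map_span_mul_eq hfix hσ hpos hI0 ha
  have hb' : span {b} ≠ ⊥ := by simpa using hb0
  obtain ⟨k, n, J, hk0, hn, hJ, hJJ⟩ := exists_mul_self_eq_span_of_map_eq hfix hσ hω (mul_ne_zero hb' hI0) hb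
  have hk0' : (k : R) ≠ 0 := by exact_mod_cast hk0
  have hJ0 : J ∈ (Ideal R)⁰ := by
    rw [mem_nonZeroDivisors_iff_ne_zero]
    rintro rfl
    exact mul_ne_zero hb' hI0 (by rw [hJ, mul_zero])
  have hcl : ClassGroup.mk0 ⟨I, hI⟩ = ClassGroup.mk0 ⟨J, hJ0⟩ :=
    ClassGroup.mk0_eq_mk0_iff.mpr ⟨b, k, hb0, hk0', hJ⟩
  rw [hcl]
  have hp0 : (p : R) ≠ 0 := by exact_mod_cast hp.ne_zero
  obtain ⟨m₁, m₂, h₁, h₂, rfl⟩ := (Nat.dvd_mul).mp hn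
  rw [Nat.dvd_prime hp] at h₁
  rw [Nat.dvd_prime hq] at h₂
  obtain rfl | rfl := h₁ <;> obtain rfl | rfl := h₂
  · left
    have : J = 1 := eq_of_mul_self_eq (by rw [hJJ]; simp)
    rw [ClassGroup.mk0_eq_one_iff, this]
    exact ⟨1, by simp⟩
  · right
    refine ClassGroup.mk0_eq_mk0_iff.mpr ⟨p, ω - σ ω, hp0, ?_, ?_⟩
    · intro h
      rw [h, mul_zero, zero_eq_neg] at hω
      exact mul_ne_zero hp.ne_zero hq.ne_zero (by exact_mod_cast hω)
    · refine eq_of_mul_self_eq ?_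
      dsimp only
      rw [mul_mul_mul_comm (span {(p : R)}), mul_mul_mul_comm (span {ω - σ ω}), hJJ, hPP, span_singleton_mul_span_singleton,
        span_singleton_mul_span_singleton, span_singleton_mul_span_singleton,
        span_singleton_mul_span_singleton, hω, neg_mul, span_singleton_neg]
      push_cast
      congr 2
      ring
  · right
    have : J = span {(m₁ : R), ω - σ ω} := eq_of_mul_self_eq (by rw [hJJ, hPP, mul_one])
    simp only [this]
  · left
    have : J = span {ω - σ ω} := eq_of_mul_self_eq (by
      rw [hJJ, span_singleton_mul_span_singleton, hω, span_singleton_neg])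
    rw [ClassGroup.mk0_eq_one_iff, this]
    exact ⟨_, rfl⟩

open nonZeroDivisors in
theorem exists_sq_eq_mk0 (hfix : ∀ x, σ x = x → ∃ n : ℤ, x = n)
    (hσ : ∀ x, σ (σ x) = x) {p : ℕ} (hp : p ≠ 0) {P : Ideal R} (hP : P ∈ (Ideal R)⁰)
    (hPP : P * P = span {(p : R)}) (hPσ : P.map σ = P) {a : R} {z : ℤ} (hz : z ≠ 0)
    (ha : a * σ a = p * z ^ 2) :
    ∃ C : ClassGroup R, C ^ 2 = ClassGroup.mk0 ⟨P, hP⟩ := by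
  have hp0 : (p : R) ≠ 0 := by exact_mod_cast hp
  have hz0 : (z : R) ≠ 0 := by exact_mod_cast hz
  have ha0 : a ≠ 0 := by
    rintro rfl
    rw [zero_mul] at ha
    exact mul_ne_zero hp0 (pow_ne_zero 2 hz0) ha.symm
  set c : R := p * z with hc
  have hc0 : c ≠ 0 := mul_ne_zero hp0 hz0
  set B : Ideal R := span {c} + span {a} * P with hB
  have hB0 : B ≠ ⊥ := by
    intro h
    have : c ∈ B := mem_sup_left (mem_span_singleton_self c)
    rw [h] at this
    exact hc0 (by simpa using this)
  have hBσ : B.map σ = span {c} + span {σ a} * P := by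
    rw [hB, Submodule.add_eq_sup, Ideal.map_sup, Ideal.map_mul, hPσ, map_span, map_span,
      Set.image_singleton, Set.image_singleton, hc, map_mul, map_natCast, map_intCast,
      Submodule.add_eq_sup]
  have hkey : span {a} * P * B.map σ = span {c} * B := by
    have h : span {a} * span {σ a} * (P * P) = span {c} * span {c} := by
      rw [hPP, span_singleton_mul_span_singleton, span_singleton_mul_span_singleton,
        span_singleton_mul_span_singleton, ha, hc]
      congr 2
      ring
    rw [hBσ, hB]
    calc span {a} * P * (span {c} + span {σ a} * P)
        = span {a} * span {σ a} * (P * P) + span {c} * (span {a} * P) := by ring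
      _ = _ := by rw [h]; ring
  obtain ⟨m, hm0, hm⟩ := exists_mul_map_eq_span hfix hσ hB0
  have hm0' : (m : R) ≠ 0 := by exact_mod_cast hm0
  have hBmem : B ∈ (Ideal R)⁰ := mem_nonZeroDivisors_iff_ne_zero.mpr hB0
  refine ⟨ClassGroup.mk0 ⟨B, hBmem⟩, ?_⟩
  rw [sq, ← map_mul, Submonoid.mk_mul_mk]
  refine ClassGroup.mk0_eq_mk0_iff.mpr ⟨c, a * m, hc0, mul_ne_zero ha0 hm0', ?_⟩
  dsimp only
  rw [← span_singleton_mul_span_singleton a, ← hm, ← mul_assoc, ← hkey]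
  ring

end Conj

end

theorem isCyclic_and_four_dvd_card_sylow {G : Type*} [CommGroup G] [Finite G] {t b : G}
    (ht : t ≠ 1) (hb : b ^ 2 = t) (h : ∀ x : G, x ^ 2 = 1 → x = 1 ∨ x = t) (ht2 : t ^ 2 = 1) :
    (∀ P : Sylow 2 G, IsCyclic P ∧ 4 ∣ Nat.card P) ∧ 4 ∣ Nat.card G := by
  have h4 : 2 ^ 2 ∣ Nat.card G := by
    have : orderOf b = 2 ^ (1 + 1) :=
      orderOf_eq_prime_pow (by simpa [hb] using ht) (by rw [pow_succ, pow_mul, pow_one, hb, ht2])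
    exact this ▸ orderOf_dvd_natCard b
  refine ⟨fun P => ⟨?_, P.pow_dvd_card_of_pow_dvd_card h4⟩, h4⟩
  have hP (x : P) (hx : x ^ 2 = 1) : (x : G) = 1 ∨ (x : G) = t :=
    h x (by exact_mod_cast congrArg (Subtype.val : P → G) hx)
  by_cases htP : t ∈ P
  · exact isCyclic_of_sq_eq_one P.isPGroup' ⟨t, htP⟩ fun x hx =>
      (hP x hx).imp (fun h => Subtype.ext h) (fun h => Subtype.ext h)
  · exact isCyclic_of_sq_eq_one P.isPGroup' 1 fun x hx =>
      Or.inl ((hP x hx).elim (fun h => Subtype.ext h) (fun h => absurd (h ▸ x.2) htP))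

section Qsqrtneg

theorem I_mul_sqrt_mul_self (n : ℕ) :
    (Complex.I * Real.sqrt n : ℂ) * (Complex.I * Real.sqrt n) = -n := by
  have h : ((Real.sqrt n : ℝ) : ℂ) * (Real.sqrt n : ℝ) = n := by
    rw [← Complex.ofReal_mul, Real.mul_self_sqrt (Nat.cast_nonneg n), Complex.ofReal_natCast]
  linear_combination ((Real.sqrt n : ℝ) : ℂ) * (Real.sqrt n : ℝ) * Complex.I_mul_I - h

theorem conj_I_mul_sqrt (n : ℕ) :
    (starRingEnd ℂ) (Complex.I * Real.sqrt n) = -(Complex.I * Real.sqrt n) := by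
  simp

theorem isIntegral_I_mul_sqrt (n : ℕ) {R : Type*} [CommRing R] [Algebra R ℂ] :
    IsIntegral R (Complex.I * Real.sqrt n : ℂ) := by
  refine IsIntegral.of_pow (n := 2) two_pos ?_
  rw [sq, I_mul_sqrt_mul_self, ← map_natCast (algebraMap R ℂ), ← map_neg]
  exact isIntegral_algebraMap

theorem exists_eq_add_mul_of_mem_Qsqrtneg {n : ℕ} {x : ℂ} (hx : x ∈ Qsqrtneg n) :
    ∃ a b : ℚ, x = a + b * (Complex.I * Real.sqrt n) := by
  rw [Qsqrtneg, ← IntermediateField.mem_toSubalgebra,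
    adjoin_simple_toSubalgebra_of_isAlgebraic (isIntegral_I_mul_sqrt n).isAlgebraic] at hx
  induction hx using Algebra.adjoin_induction with
  | mem x hx => exact ⟨0, 1, by simp [Set.mem_singleton_iff.mp hx]⟩
  | algebraMap r => exact ⟨r, 0, by simp⟩
  | add x y _ _ hx hy =>
    obtain ⟨a, b, rfl⟩ := hx
    obtain ⟨c, d, rfl⟩ := hy
    exact ⟨a + c, b + d, by push_cast; ring⟩
  | mul x y _ _ hx hy =>
    obtain ⟨a, b, rfl⟩ := hx
    obtain ⟨c, d, rfl⟩ := hy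
    refine ⟨a * c - b * d * n, a * d + b * c, ?_⟩
    push_cast
    linear_combination (b : ℂ) * d * I_mul_sqrt_mul_self n

theorem I_mul_sqrt_mem_Qsqrtneg (n : ℕ) : (Complex.I * Real.sqrt n : ℂ) ∈ Qsqrtneg n :=
  mem_adjoin_simple_self ℚ _

theorem conj_mem_Qsqrtneg {n : ℕ} {x : ℂ} (hx : x ∈ Qsqrtneg n) :
    (starRingEnd ℂ) x ∈ Qsqrtneg n := by
  obtain ⟨a, b, rfl⟩ := exists_eq_add_mul_of_mem_Qsqrtneg hx
  rw [map_add, map_mul, conj_I_mul_sqrt]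
  simp only [map_ratCast]
  exact add_mem (SubfieldClass.ratCast_mem _ a)
    (mul_mem (SubfieldClass.ratCast_mem _ b) (neg_mem (I_mul_sqrt_mem_Qsqrtneg n)))

/-- Complex conjugation on `ℚ(√-n)`. -/
noncomputable def conjQsqrtneg (n : ℕ) : Qsqrtneg n ≃+* Qsqrtneg n where
  toFun x := ⟨(starRingEnd ℂ) x, conj_mem_Qsqrtneg x.2⟩
  invFun x := ⟨(starRingEnd ℂ) x, conj_mem_Qsqrtneg x.2⟩
  left_inv _ := Subtype.ext (Complex.conj_conj _)
  right_inv _ := Subtype.ext (Complex.conj_conj _)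
  map_mul' _ _ := Subtype.ext (map_mul (starRingEnd ℂ) _ _)
  map_add' _ _ := Subtype.ext (map_add (starRingEnd ℂ) _ _)

/-- Complex conjugation on the ring of integers of `ℚ(√-n)`. -/
noncomputable def conjIntegers (n : ℕ) : 𝓞 (Qsqrtneg n) ≃+* 𝓞 (Qsqrtneg n) :=
  RingOfIntegers.mapRingEquiv (conjQsqrtneg n)

/-- The embedding of the ring of integers of `ℚ(√-n)` into `ℂ`. -/
noncomputable def integersToComplex (n : ℕ) : 𝓞 (Qsqrtneg n) →+* ℂ :=
  (Qsqrtneg n).val.toRingHom.comp (algebraMap (𝓞 (Qsqrtneg n)) (Qsqrtneg n))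

theorem integersToComplex_injective (n : ℕ) : Function.Injective (integersToComplex n) :=
  (Qsqrtneg n).val.toRingHom.injective.comp RingOfIntegers.coe_injective

theorem integersToComplex_mem (n : ℕ) (x : 𝓞 (Qsqrtneg n)) :
    integersToComplex n x ∈ Qsqrtneg n :=
  (x : Qsqrtneg n).2

theorem integersToComplex_conj (n : ℕ) (x : 𝓞 (Qsqrtneg n)) :
    integersToComplex n (conjIntegers n x) = (starRingEnd ℂ) (integersToComplex n x) :=
  rfl

theorem isIntegral_integersToComplex (n : ℕ) (x : 𝓞 (Qsqrtneg n)) :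
    IsIntegral ℤ (integersToComplex n x) :=
  map_isIntegral_int (Qsqrtneg n).val.toRingHom (RingOfIntegers.isIntegral_coe x)

theorem exists_integersToComplex_eq {n : ℕ} {z : ℂ} (hz : z ∈ Qsqrtneg n)
    (hz' : IsIntegral ℤ z) : ∃ x : 𝓞 (Qsqrtneg n), integersToComplex n x = z := by
  have h : IsIntegral ℤ (⟨z, hz⟩ : Qsqrtneg n) :=
    (isIntegral_algHom_iff ((Qsqrtneg n).val.restrictScalars ℤ) Subtype.val_injective).mp hz'
  exact ⟨⟨⟨z, hz⟩, h⟩, rfl⟩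

theorem conjIntegers_conjIntegers (n : ℕ) (x : 𝓞 (Qsqrtneg n)) :
    conjIntegers n (conjIntegers n x) = x := by
  apply integersToComplex_injective
  simp [integersToComplex_conj]

theorem exists_eq_intCast_of_conjIntegers_eq {n : ℕ} (x : 𝓞 (Qsqrtneg n))
    (hx : conjIntegers n x = x) : ∃ m : ℤ, x = m := by
  have hc := congrArg (integersToComplex n) hx
  rw [integersToComplex_conj] at hc
  obtain ⟨a, b, hab⟩ := exists_eq_add_mul_of_mem_Qsqrtneg (integersToComplex_mem n x)
  have hx' : integersToComplex n x = algebraMap ℚ ℂ a := by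
    rw [hab, map_add, map_mul, conj_I_mul_sqrt, map_ratCast, map_ratCast] at hc
    rw [hab, eq_ratCast]
    linear_combination -(1 / 2 : ℂ) * hc
  have hint := isIntegral_integersToComplex n x
  rw [hx', isIntegral_algebraMap_iff (algebraMap ℚ ℂ).injective] at hint
  obtain ⟨m, hm⟩ := IsIntegrallyClosed.isIntegral_iff.mp hint
  refine ⟨m, integersToComplex_injective n ?_⟩
  rw [hx', ← hm]
  simp

theorem exists_mul_conjIntegers_eq_natCast {n : ℕ} (x : 𝓞 (Qsqrtneg n)) :
    ∃ m : ℕ, x * conjIntegers n x = m := by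
  obtain ⟨m, hm⟩ := exists_eq_intCast_of_conjIntegers_eq (x * conjIntegers n x)
    (by rw [map_mul, conjIntegers_conjIntegers, mul_comm])
  have hm0 : 0 ≤ m := by
    have h := congrArg (integersToComplex n) hm
    rw [map_mul, integersToComplex_conj, Complex.mul_conj, map_intCast] at h
    have h' : Complex.normSq (integersToComplex n x) = m := by exact_mod_cast h
    exact_mod_cast h' ▸ Complex.normSq_nonneg _
  lift m to ℕ using hm0
  exact ⟨m, by simpa using hm⟩

theorem exists_sub_conjIntegers_mul_self {n : ℕ} (hn : n % 4 = 3) :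
    ∃ ω : 𝓞 (Qsqrtneg n), (ω - conjIntegers n ω) * (ω - conjIntegers n ω) = -(n : 𝓞 _) := by
  obtain ⟨k, hk⟩ : ∃ k : ℕ, n + 1 = 4 * k := ⟨(n + 1) / 4, by lia⟩
  have hk' : (n : ℂ) + 1 = 4 * k := by exact_mod_cast hk
  have hsq := I_mul_sqrt_mul_self n
  obtain ⟨ω, hω⟩ := exists_integersToComplex_eq (n := n)
    (z := (1 + Complex.I * Real.sqrt n) * ((1 / 2 : ℚ) : ℂ))
    (mul_mem (add_mem (one_mem _) (I_mul_sqrt_mem_Qsqrtneg n)) (SubfieldClass.ratCast_mem _ _)) (by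
      refine ⟨Polynomial.X ^ 2 - Polynomial.X + Polynomial.C (k : ℤ), by monicity!, ?_⟩
      simp only [Polynomial.eval₂_add, Polynomial.eval₂_sub, Polynomial.eval₂_pow,
        Polynomial.eval₂_X, Polynomial.eval₂_C]
      push_cast
      linear_combination (1 / 4 : ℂ) * hsq - (1 / 4 : ℂ) * hk')
  refine ⟨ω, integersToComplex_injective n ?_⟩
  rw [map_mul, map_sub, integersToComplex_conj, hω, map_neg, map_natCast, map_mul, map_add,
    conj_I_mul_sqrt, map_one, map_ratCast]
  push_cast
  linear_combination hsq

end Qsqrtneg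

/-- For primes `p ≡ 5 mod 8` and `q ≡ 3 mod 4` with `(p/q) = 1`, the `2`-Sylow subgroup of
the class group of `ℚ(√-pq)` is cyclic of order divisible by `4`; in particular `4`
divides the class number. -/
theorem two_sylow_classgroup_cyclic_of_pq
    (p q : ℕ) (hp : p.Prime) (hq : q.Prime)
    (hp8 : p % 8 = 5) (hq4 : q % 4 = 3) (hres : IsSquare ((p : ZMod q)))
    [NumberField (Qsqrtneg (p * q))] :
    (∀ P : Sylow 2 (ClassGroup (𝓞 (Qsqrtneg (p * q)))),
      IsCyclic P ∧ 4 ∣ Nat.card P) ∧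
    4 ∣ NumberField.classNumber (Qsqrtneg (p * q)) := by
  have : Fact q.Prime := ⟨hq⟩
  have : Fact p.Prime := ⟨hp⟩
  have hne : p ≠ q := by lia
  have hpq3 : (p * q) % 4 = 3 := by
    rw [Nat.mul_mod, hq4, show p % 4 = 1 by lia]
  have hfix := exists_eq_intCast_of_conjIntegers_eq (n := p * q)
  have hσ := conjIntegers_conjIntegers (p * q)
  have hpos := exists_mul_conjIntegers_eq_natCast (n := p * q)
  obtain ⟨ω, hω⟩ := exists_sub_conjIntegers_mul_self hpq3
  set σ := conjIntegers (p * q)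
  have hσd : σ (ω - σ ω) = -(ω - σ ω) := by rw [map_sub, hσ, neg_sub]
  have hPP := span_pair_mul_span_pair ((Nat.coprime_primes hp hq).mpr hne) hω
  have hP : Ideal.span {(p : 𝓞 (Qsqrtneg (p * q))), ω - σ ω} ∈
      nonZeroDivisors (Ideal (𝓞 (Qsqrtneg (p * q)))) := by
    rw [mem_nonZeroDivisors_iff_ne_zero]
    intro h
    rw [h, mul_zero] at hPP
    simpa [hp.ne_zero] using hPP.symm
  obtain ⟨x, y, z, hz, hxyz⟩ := exists_sq_eq_mul_sq_add_mul_sq hp hq hres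
    ((ZMod.exists_sq_eq_prime_iff_of_mod_four_eq_one (by lia) (by lia)).mpr hres) hne
  have ha : (p * x + y * (ω - σ ω)) * σ (p * x + y * (ω - σ ω)) =
      (p : 𝓞 (Qsqrtneg (p * q))) * z ^ 2 := by
    have h : (z : 𝓞 (Qsqrtneg (p * q))) ^ 2 = p * x ^ 2 + q * y ^ 2 := by
      exact_mod_cast congrArg (Int.cast : ℤ → 𝓞 (Qsqrtneg (p * q))) hxyz
    rw [h, map_add, map_mul, map_mul, map_natCast, map_intCast, map_intCast, hσd]
    push_cast at hω
    linear_combination -(y : 𝓞 (Qsqrtneg (p * q))) ^ 2 * hω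
  obtain ⟨C, hC⟩ := exists_sq_eq_mk0 hfix hσ hp.ne_zero hP hPP (map_span_pair hσd) hz ha
  rw [NumberField.classNumber, ← Nat.card_eq_fintype_card]
  refine isCyclic_and_four_dvd_card_sylow (t := ClassGroup.mk0 ⟨_, hP⟩) ?_ hC
    (fun x hx => eq_one_or_eq_mk0_of_sq_eq_one hfix hσ hpos hp hq hne hω hP hx) ?_
  · rw [ne_eq, ClassGroup.mk0_eq_one_iff]
    exact not_isPrincipal_span_pair hfix hσ hpos hp hq hp8 hq4 hω hσd
  · rw [sq, ← map_mul, Submonoid.mk_mul_mk, ClassGroup.mk0_eq_one_iff, hPP]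
    exact ⟨_, rfl⟩
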